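/- Let a ≥ 0, b > 0, c > 0 and define g : S₀ → ℝ by g(Q) = −(a/2)tr(Q²) − (b/3)tr(Q³) + (c/4)(tr(Q²))². Then g attains its minimum over S₀, and the set of minimizers is exactly U_* = { s_*(n⊗n − I/3) : n ∈ S² }, where s_* = (b + √(b² + 24ac))/(4c). Equivalently, with C₀ = −min g and f = g + C₀, one has f ≥ 0 on S₀ and {Q ∈ S₀ : f(Q) = 0} = U_*. -/

import Mathlib

open MeasureTheory Filter Metric Real Set
open scoped ENNReal NNReal
noncomputable section

abbrev E3 : Type := EuclideanSpace ℝ (Fin 3)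
abbrev Mat3 : Type := Matrix (Fin 3) (Fin 3) ℝ

def isS0 (Q : Mat3) : Prop := Q.IsSymm ∧ Q.trace = 0
def minner (A B : Mat3) : ℝ := (A * B).trace
def mnormSq (A : Mat3) : ℝ := (A * A).trace
def mnorm (A : Mat3) : ℝ := Real.sqrt (mnormSq A)
def outer (u v : E3) : Mat3 := Matrix.of fun i j => u i * v j
def ez : E3 := EuclideanSpace.single 2 1
def er (x : E3) : E3 := ‖x‖⁻¹ • x
def sstar (a b c : ℝ) : ℝ := (b + Real.sqrt (b ^ 2 + 24 * a * c)) / (4 * c)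
def Qinf (a b c : ℝ) : Mat3 := sstar a b c • (outer ez ez - (1 / 3 : ℝ) • (1 : Mat3))
def Qsurf (a b c : ℝ) (x : E3) : Mat3 :=
  sstar a b c • (outer (er x) (er x) - (1 / 3 : ℝ) • (1 : Mat3))
def Omega : Set E3 := {x | 1 < ‖x‖}
def OmegaBar : Set E3 := {x | 1 ≤ ‖x‖}

def pd (g : E3 → ℝ) (k : Fin 3) : E3 → ℝ :=
  fun x => fderivWithin ℝ g OmegaBar x (EuclideanSpace.single k 1)
def lap3 (g : E3 → ℝ) (x : E3) : ℝ := ∑ k, pd (pd g k) k x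
def matLap (Q : E3 → Mat3) (x : E3) : Mat3 := Matrix.of fun i j => lap3 (fun y => Q y i j) x
def gradSq (Q : E3 → Mat3) (x : E3) : ℝ := ∑ i, ∑ j, ∑ k, (pd (fun y => Q y i j) k x) ^ 2
def nuDeriv (Q : E3 → Mat3) (x : E3) : Mat3 :=
  Matrix.of fun i j => fderivWithin ℝ (fun y => Q y i j) OmegaBar x (-(er x))

def gradf (a b c : ℝ) (Q : Mat3) : Mat3 :=
  (-a) • Q - b • (Q * Q - (mnormSq Q / 3) • (1 : Mat3)) + (c * mnormSq Q) • Q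

def gpot (a b c : ℝ) (Q : Mat3) : ℝ :=
  -(a / 2) * (Q * Q).trace - (b / 3) * (Q * Q * Q).trace + (c / 4) * ((Q * Q).trace) ^ 2
def Cconst (a b c : ℝ) : ℝ := -sInf (gpot a b c '' {Q | isS0 Q})
def fpot (a b c : ℝ) (Q : Mat3) : ℝ := gpot a b c Q + Cconst a b c

def RegC (m : ℕ) (Q : E3 → Mat3) : Prop :=
  ∀ i j, ContDiffOn ℝ m (fun x => Q x i j) OmegaBar

def memH (a b c : ℝ) (Q : E3 → Mat3) : Prop :=
  (∀ x ∈ OmegaBar, isS0 (Q x)) ∧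
  IntegrableOn (fun x => gradSq Q x) Omega volume ∧
  IntegrableOn (fun x => mnormSq (Q x - Qinf a b c) / ‖x‖ ^ 2) Omega volume

def isEL (a b c L : ℝ) (Q : E3 → Mat3) : Prop :=
  ∀ x ∈ Omega, L • matLap Q x = gradf a b c (Q x)

def weakAnchor (a b c L W : ℝ) (Q : E3 → Mat3) : Prop :=
  ∀ x : E3, ‖x‖ = 1 → (L / W) • nuDeriv Q x = Qsurf a b c x - Q x

def coef1 (w : ℝ≥0∞) : ℝ := if w = ⊤ then 1 else w.toReal / (1 + w.toReal)
def coef3 (w : ℝ≥0∞) : ℝ := if w = ⊤ then 1 else w.toReal / (3 + w.toReal)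

def Q0 (a b c : ℝ) (w : ℝ≥0∞) (x : E3) : Mat3 :=
  (sstar a b c * coef3 w / ‖x‖ ^ 3) • (outer (er x) (er x) - (1 / 3 : ℝ) • (1 : Mat3))
  + (sstar a b c * (1 - coef1 w / ‖x‖)) • (outer ez ez - (1 / 3 : ℝ) • (1 : Mat3))

def repeatedEig (Q : Mat3) : Prop := ∃ t : ℝ, 2 ≤ Polynomial.rootMultiplicity t (Matrix.charpoly Q)

def vec3 (p q r : ℝ) : E3 := (WithLp.equiv 2 (Fin 3 → ℝ)).symm ![p, q, r]

/-- The uniaxial manifold `U_* = { s_*(n⊗n − I/3) : n ∈ S² }`. -/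
def Ustar (a b c : ℝ) : Set Mat3 :=
  {Q | ∃ n : E3, ‖n‖ = 1 ∧ Q = sstar a b c • (outer n n - (1 / 3 : ℝ) • (1 : Mat3))}

theorem sstar_pos {a b c : ℝ} (ha : 0 ≤ a) (hb : 0 < b) (hc : 0 < c) : 0 < sstar a b c := by
  unfold sstar
  positivity

theorem sstar_quadratic {a b c : ℝ} (ha : 0 ≤ a) (hc : 0 < c) :
    2 * c * sstar a b c ^ 2 = b * sstar a b c + 3 * a := by
  have h : Real.sqrt (b ^ 2 + 24 * a * c) ^ 2 = b ^ 2 + 24 * a * c :=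
    Real.sq_sqrt (by positivity)
  unfold sstar
  generalize Real.sqrt (b ^ 2 + 24 * a * c) = t at h ⊢
  field_simp
  linear_combination 2 * h

theorem isSymm_orthogonal_diagonalization {Q : Mat3} (hQ : Q.IsSymm) :
    ∃ (U : Mat3) (d : Fin 3 → ℝ), U.transpose * U = 1 ∧ U * U.transpose = 1 ∧
      Q = U * Matrix.diagonal d * U.transpose := by
  have hH : Q.IsHermitian := by
    rw [Matrix.IsHermitian, Matrix.conjTranspose_eq_transpose_of_trivial]
    exact hQ
  have hstar : star (hH.eigenvectorUnitary : Mat3)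
      = (hH.eigenvectorUnitary : Mat3).transpose := by
    rw [Matrix.star_eq_conjTranspose, Matrix.conjTranspose_eq_transpose_of_trivial]
  refine ⟨hH.eigenvectorUnitary, hH.eigenvalues, ?_, ?_, ?_⟩
  · rw [← hstar]
    exact Unitary.coe_star_mul_self _
  · rw [← hstar]
    exact Unitary.coe_mul_star_self _
  · rw [← hstar]
    simpa [Unitary.conjStarAlgAut_apply, Function.comp_def] using hH.spectral_theorem

theorem six_mul_cube_sum_sq_le {x y z : ℝ} (h : x + y + z = 0) :
    6 * (x ^ 3 + y ^ 3 + z ^ 3) ^ 2 ≤ (x ^ 2 + y ^ 2 + z ^ 2) ^ 3 := by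
  obtain rfl : z = -x - y := by linarith
  have := sq_nonneg ((x - y) * (2 * x + y) * (x + 2 * y))
  nlinarith

/-- The value of the bulk potential on the uniaxial manifold. -/
def gmin (a b c : ℝ) : ℝ := b * sstar a b c ^ 3 / 27 - c * sstar a b c ^ 4 / 9

theorem bulk_sub_gmin {a b c : ℝ} (ha : 0 ≤ a) (hc : 0 < c) (p q : ℝ) :
    -(a / 2) * p - (b / 3) * q + (c / 4) * p ^ 2 - gmin a b c =
      c / 4 * (p - 2 * sstar a b c ^ 2 / 3) ^ 2 +
        b * (sstar a b c * p / 6 - q / 3 - sstar a b c ^ 3 / 27) := by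
  have h := sstar_quadratic (b := b) ha hc
  unfold gmin
  linear_combination (p / 6) * h

theorem bulk_sub_gmin_lower_bound {a b c p q r : ℝ} (ha : 0 ≤ a) (hb : 0 < b) (hc : 0 < c)
    (hp : p = 2 * r ^ 2 / 3) :
    b * ((r - sstar a b c) ^ 2 * (3 * r ^ 2 + 2 * r * sstar a b c + sstar a b c ^ 2)
        / (54 * sstar a b c) + (2 * r ^ 3 / 9 - q) / 3) ≤
      -(a / 2) * p - (b / 3) * q + (c / 4) * p ^ 2 - gmin a b c := by
  rw [bulk_sub_gmin ha hc]
  have hs := sstar_pos ha hb hc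
  have hquad := sstar_quadratic (b := b) ha hc
  set s := sstar a b c
  have hcs : b / (2 * s) ≤ c := by
    rw [div_le_iff₀ (by positivity)]
    nlinarith
  have h1 : b / (2 * s) / 4 * (p - 2 * s ^ 2 / 3) ^ 2 ≤ c / 4 * (p - 2 * s ^ 2 / 3) ^ 2 := by
    gcongr
  refine le_trans (le_of_eq ?_) (add_le_add_left h1 _)
  subst hp
  field_simp
  ring

theorem bulk_scalar {a b c x y z : ℝ} (ha : 0 ≤ a) (hb : 0 < b) (hc : 0 < c)
    (h : x + y + z = 0) :
    gmin a b c ≤ -(a / 2) * (x ^ 2 + y ^ 2 + z ^ 2) - (b / 3) * (x ^ 3 + y ^ 3 + z ^ 3)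
        + (c / 4) * (x ^ 2 + y ^ 2 + z ^ 2) ^ 2 ∧
    (-(a / 2) * (x ^ 2 + y ^ 2 + z ^ 2) - (b / 3) * (x ^ 3 + y ^ 3 + z ^ 3)
        + (c / 4) * (x ^ 2 + y ^ 2 + z ^ 2) ^ 2 = gmin a b c →
      x ^ 2 + y ^ 2 + z ^ 2 = 2 * sstar a b c ^ 2 / 3 ∧
      x ^ 3 + y ^ 3 + z ^ 3 = 2 * sstar a b c ^ 3 / 9) := by
  have hcube := six_mul_cube_sum_sq_le h
  have hp0 : 0 ≤ x ^ 2 + y ^ 2 + z ^ 2 := by positivity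
  set p := x ^ 2 + y ^ 2 + z ^ 2
  set q := x ^ 3 + y ^ 3 + z ^ 3
  obtain ⟨r, hr, hp⟩ : ∃ r : ℝ, 0 ≤ r ∧ p = 2 * r ^ 2 / 3 := by
    refine ⟨Real.sqrt (3 * p / 2), Real.sqrt_nonneg _, ?_⟩
    rw [Real.sq_sqrt (by positivity)]
    ring
  have hq : q ≤ 2 * r ^ 3 / 9 := by
    refine (abs_le_of_sq_le_sq' ?_ (by positivity)).2
    rw [hp] at hcube
    nlinarith
  have hlow := bulk_sub_gmin_lower_bound (q := q) ha hb hc hp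
  have hs := sstar_pos ha hb hc
  set s := sstar a b c
  have hA : 0 ≤ (r - s) ^ 2 * (3 * r ^ 2 + 2 * r * s + s ^ 2) / (54 * s) := by positivity
  have hB : 0 ≤ (2 * r ^ 3 / 9 - q) / 3 := by linarith
  constructor
  · have := mul_nonneg hb.le (add_nonneg hA hB)
    linarith
  · intro heq
    have hle : (r - s) ^ 2 * (3 * r ^ 2 + 2 * r * s + s ^ 2) / (54 * s)
        + (2 * r ^ 3 / 9 - q) / 3 ≤ 0 := by
      by_contra hcon
      have := mul_pos hb (not_le.mp hcon)
      linarith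
    have hA0 : (r - s) ^ 2 * (3 * r ^ 2 + 2 * r * s + s ^ 2) / (54 * s) = 0 := by linarith
    have hrs : r = s := by
      have h3 : 3 * r ^ 2 + 2 * r * s + s ^ 2 ≠ 0 := by positivity
      have h4 : 54 * s ≠ 0 := by positivity
      simp only [div_eq_zero_iff, mul_eq_zero, h3, or_false, pow_eq_zero_iff, ne_eq,
        OfNat.ofNat_ne_zero, not_false_eq_true, hs.ne'] at hA0
      linarith
    subst hrs
    exact ⟨hp, by linarith⟩

/-- Three reals with the power sums of `(2s/3, -s/3, -s/3)` are a permutation of it. -/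
theorem eq_ite_of_power_sums {s : ℝ} (hs : 0 < s) {d : Fin 3 → ℝ}
    (h1 : d 0 + d 1 + d 2 = 0)
    (h2 : d 0 ^ 2 + d 1 ^ 2 + d 2 ^ 2 = 2 * s ^ 2 / 3)
    (h3 : d 0 ^ 3 + d 1 ^ 3 + d 2 ^ 3 = 2 * s ^ 3 / 9) :
    ∃ k, d = fun i => s * ((if i = k then 1 else 0) - 1 / 3) := by
  have key : ∀ x y z : ℝ, x + y + z = 0 → x ^ 2 + y ^ 2 + z ^ 2 = 2 * s ^ 2 / 3 →
      x ^ 3 + y ^ 3 + z ^ 3 = 2 * s ^ 3 / 9 → x = 2 * s / 3 ∨ x = -s / 3 := by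
    intro x y z e1 e2 e3
    obtain rfl : z = -x - y := by linarith
    have : (x - 2 * s / 3) * (x + s / 3) ^ 2 = 0 := by
      linear_combination (x / 2) * e2 + e3 / 3
    rcases mul_eq_zero.mp this with h | h
    · left; linarith
    · right; have := pow_eq_zero_iff (two_ne_zero) |>.mp h; linarith
  have k0 := key _ _ _ h1 h2 h3
  have k1 := key (d 1) (d 0) (d 2) (by linarith) (by linarith) (by linarith)
  have k2 := key (d 2) (d 0) (d 1) (by linarith) (by linarith) (by linarith)
  rcases k0 with k0 | k0 <;> rcases k1 with k1 | k1 <;> rcases k2 with k2 | k2 <;>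
    first
    | (exfalso; linarith)
    | (refine ⟨0, ?_⟩; funext i; fin_cases i <;> simp [k0, k1, k2] <;> linarith)
    | (refine ⟨1, ?_⟩; funext i; fin_cases i <;> simp [k0, k1, k2] <;> linarith)
    | (refine ⟨2, ?_⟩; funext i; fin_cases i <;> simp [k0, k1, k2] <;> linarith)

theorem trace_conj_diagonal {U : Mat3} (hU : U.transpose * U = 1) (d : Fin 3 → ℝ) :
    (U * Matrix.diagonal d * U.transpose).trace = d 0 + d 1 + d 2 := by
  rw [Matrix.trace_mul_comm, ← Matrix.mul_assoc, hU, Matrix.one_mul, Matrix.trace_diagonal,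
    Fin.sum_univ_three]

theorem conj_diagonal_mul {U : Mat3} (hU : U.transpose * U = 1) (d e : Fin 3 → ℝ) :
    U * Matrix.diagonal d * U.transpose * (U * Matrix.diagonal e * U.transpose) =
      U * Matrix.diagonal (fun i => d i * e i) * U.transpose := by
  rw [← Matrix.diagonal_mul_diagonal]
  calc _ = U * Matrix.diagonal d * (U.transpose * U) * Matrix.diagonal e * U.transpose := by
        simp only [Matrix.mul_assoc]
    _ = _ := by rw [hU]; simp only [Matrix.mul_assoc, Matrix.one_mul]

theorem gpot_conj_diagonal (a b c : ℝ) {U : Mat3} (hU : U.transpose * U = 1) (d : Fin 3 → ℝ) :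
    gpot a b c (U * Matrix.diagonal d * U.transpose) =
      -(a / 2) * (d 0 ^ 2 + d 1 ^ 2 + d 2 ^ 2) - (b / 3) * (d 0 ^ 3 + d 1 ^ 3 + d 2 ^ 3)
        + (c / 4) * (d 0 ^ 2 + d 1 ^ 2 + d 2 ^ 2) ^ 2 := by
  unfold gpot
  simp only [conj_diagonal_mul hU, trace_conj_diagonal hU]
  ring

theorem gmin_le_gpot {a b c : ℝ} (ha : 0 ≤ a) (hb : 0 < b) (hc : 0 < c) {Q : Mat3}
    (hQ : isS0 Q) : gmin a b c ≤ gpot a b c Q := by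
  obtain ⟨U, d, hU, -, rfl⟩ := isSymm_orthogonal_diagonalization hQ.1
  rw [gpot_conj_diagonal a b c hU]
  exact (bulk_scalar ha hb hc ((trace_conj_diagonal hU d).symm.trans hQ.2)).1

theorem mem_Ustar_of_gpot_eq {a b c : ℝ} (ha : 0 ≤ a) (hb : 0 < b) (hc : 0 < c) {Q : Mat3}
    (hQ : isS0 Q) (h : gpot a b c Q = gmin a b c) : Q ∈ Ustar a b c := by
  obtain ⟨U, d, hU, hU', rfl⟩ := isSymm_orthogonal_diagonalization hQ.1
  rw [gpot_conj_diagonal a b c hU] at h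
  have hsum := (trace_conj_diagonal hU d).symm.trans hQ.2
  obtain ⟨h2, h3⟩ := (bulk_scalar ha hb hc hsum).2 h
  obtain ⟨k, rfl⟩ := eq_ite_of_power_sums (sstar_pos ha hb hc) hsum h2 h3
  refine ⟨WithLp.toLp 2 (fun i => U i k), ?_, ?_⟩
  · have hk := congrFun (congrFun hU k) k
    simp only [Matrix.mul_apply, Matrix.transpose_apply, Matrix.one_apply_eq] at hk
    rw [EuclideanSpace.norm_eq, Real.sqrt_eq_one, ← hk]
    simp [pow_two]
  · have hd : Matrix.diagonal (fun i => sstar a b c * ((if i = k then 1 else 0) - 1 / 3)) =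
        sstar a b c • (Matrix.single k k (1 : ℝ) - (1 / 3 : ℝ) • (1 : Mat3)) := by
      ext i j
      by_cases hij : i = j
      · subst hij
        by_cases hik : i = k
        · subst hik; simp
        · simp [hik, Ne.symm hik]
      · have : ¬ (k = i ∧ k = j) := fun h => hij (h.1.symm.trans h.2)
        simp [hij, this]
    have ho : U * Matrix.single k k (1 : ℝ) * U.transpose =
        outer (WithLp.toLp 2 fun i => U i k) (WithLp.toLp 2 fun i => U i k) := by
      ext i j
      simp [outer, Matrix.mul_apply, Matrix.single_apply, ite_and]
    rw [hd, Matrix.mul_smul, Matrix.smul_mul, Matrix.mul_sub, Matrix.sub_mul, ho,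
      Matrix.mul_smul, Matrix.smul_mul, Matrix.mul_one, hU']

theorem isS0_and_gpot_eq_of_mem_Ustar {a b c : ℝ} (ha : 0 ≤ a) (hc : 0 < c) {Q : Mat3}
    (hQ : Q ∈ Ustar a b c) : isS0 Q ∧ gpot a b c Q = gmin a b c := by
  obtain ⟨n, hn, rfl⟩ := hQ
  have hn' : n 0 * n 0 + n 1 * n 1 + n 2 * n 2 = 1 := by
    have := EuclideanSpace.real_norm_sq_eq n
    rw [hn, Fin.sum_univ_three] at this
    linarith
  have hT : (outer n n).trace = 1 := by
    simpa [outer, Matrix.trace, Fin.sum_univ_three] using hn'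
  have hPP : outer n n * outer n n = outer n n := by
    ext i j
    simp only [outer, Matrix.mul_apply, Matrix.of_apply, Fin.sum_univ_three]
    linear_combination (n i * n j) * hn'
  have h1 : (1 : Mat3).trace = 3 := by simp
  have hsymm : (outer n n).IsSymm := by
    ext i j
    simp [outer, mul_comm]
  refine ⟨⟨?_, ?_⟩, ?_⟩
  · exact (hsymm.sub (Matrix.isSymm_one.smul _)).smul _
  · rw [Matrix.trace_smul, Matrix.trace_sub, Matrix.trace_smul, hT, h1]
    simp
  · set s := sstar a b c with hs
    have h2 : (s • (outer n n - (1 / 3 : ℝ) • (1 : Mat3))) *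
        (s • (outer n n - (1 / 3 : ℝ) • (1 : Mat3))) =
        s ^ 2 • ((1 / 3 : ℝ) • outer n n + (1 / 9 : ℝ) • (1 : Mat3)) := by
      simp only [Matrix.mul_smul, Matrix.smul_mul, Matrix.mul_sub, Matrix.sub_mul, hPP,
        Matrix.mul_one, Matrix.one_mul]
      module
    have h3 : s ^ 2 • ((1 / 3 : ℝ) • outer n n + (1 / 9 : ℝ) • (1 : Mat3)) *
        (s • (outer n n - (1 / 3 : ℝ) • (1 : Mat3))) =
        s ^ 3 • ((1 / 3 : ℝ) • outer n n - (1 / 27 : ℝ) • (1 : Mat3)) := by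
      simp only [Matrix.mul_smul, Matrix.smul_mul, Matrix.mul_sub, Matrix.add_mul, hPP,
        Matrix.mul_one, Matrix.one_mul]
      module
    unfold gpot
    rw [h2, h3]
    simp only [Matrix.trace_smul, Matrix.trace_sub, Matrix.trace_add, hT, h1, smul_eq_mul]
    rw [← sub_eq_zero, bulk_sub_gmin ha hc, ← hs]
    ring

/-- the bulk potential `g` attains its minimum over `S₀` and the set of
minimizers is exactly `U_*`; equivalently, with `C₀ = −min g` and `f = g + C₀`, one has
`f ≥ 0` on `S₀` with zero set exactly `U_*`. -/
theorem bulk_potential_minimizers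
    (a b c : ℝ) (ha : 0 ≤ a) (hb : 0 < b) (hc : 0 < c) :
    ∃ m : ℝ,
      (∀ Q : Mat3, isS0 Q → m ≤ gpot a b c Q) ∧
      {Q : Mat3 | isS0 Q ∧ gpot a b c Q = m} = Ustar a b c ∧
      Cconst a b c = -m ∧
      (∀ Q : Mat3, isS0 Q → 0 ≤ gpot a b c Q + (-m)) ∧
      {Q : Mat3 | isS0 Q ∧ gpot a b c Q + (-m) = 0} = Ustar a b c := by
  have hset : {Q : Mat3 | isS0 Q ∧ gpot a b c Q = gmin a b c} = Ustar a b c :=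
    Set.Subset.antisymm (fun Q hQ => mem_Ustar_of_gpot_eq ha hb hc hQ.1 hQ.2)
      (fun Q hQ => isS0_and_gpot_eq_of_mem_Ustar ha hc hQ)
  refine ⟨gmin a b c, fun Q hQ => gmin_le_gpot ha hb hc hQ, hset, ?_, ?_, ?_⟩
  · have hmem : sstar a b c • (outer ez ez - (1 / 3 : ℝ) • (1 : Mat3)) ∈ Ustar a b c :=
      ⟨ez, by simp [ez], rfl⟩
    have hleast : IsLeast (gpot a b c '' {Q | isS0 Q}) (gmin a b c) := by
      refine ⟨?_, ?_⟩
      · exact ⟨_, isS0_and_gpot_eq_of_mem_Ustar ha hc hmem⟩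
      · rintro _ ⟨Q, hQ, rfl⟩
        exact gmin_le_gpot ha hb hc hQ
    rw [Cconst, hleast.csInf_eq]
  · intro Q hQ
    linarith [gmin_le_gpot ha hb hc hQ]
  · simpa only [← sub_eq_add_neg, sub_eq_zero] using hset
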